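/- Let ν be an ergodic measure on a shift Ω with generic point x, and (w^{(n)}) a sequence of words in the language with |w^{(n)}| → ∞ generating a measure μ (i.e., #_u(w^{(n)})/|w^{(n)}| → μ([u]) for all words u). If for some L ∈ ℕ, β := limsup_n D_L(w^{(n)}, x) > 0, then ν([u]) ≥ (β/(2L))·μ([u]) for every word u; consequently, ν = μ. -/

import Mathlib

open Set

/-- The one-sided shift map on sequences. -/
def shiftMap {A : Type*} (x : ℕ → A) : ℕ → A := fun n => x (n + 1)

/-- A subshift: a closed, shift-invariant subset of `ℕ → A`. -/
def IsSubshift {A : Type*} [TopologicalSpace A] (Ω : Set (ℕ → A)) : Prop :=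
  IsClosed Ω ∧ ∀ x ∈ Ω, shiftMap x ∈ Ω

/-- A minimal subshift: a nonempty subshift with no proper nonempty subshift. -/
def IsMinimalSubshift {A : Type*} [TopologicalSpace A] (Ω : Set (ℕ → A)) : Prop :=
  IsSubshift Ω ∧ Ω.Nonempty ∧
    ∀ Ω' ⊆ Ω, Ω'.Nonempty → IsClosed Ω' → (∀ x ∈ Ω', shiftMap x ∈ Ω') → Ω' = Ω

/-- Aperiodicity: no point of `Ω` is periodic. -/
def IsAperiodic {A : Type*} (Ω : Set (ℕ → A)) : Prop :=
  ∀ x ∈ Ω, ∀ p, 0 < p → ∃ n, x (n + p) ≠ x n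

/-- The word `w` occurs in `x` beginning at (0-indexed) position `i`. -/
def occursAt {A : Type*} (x : ℕ → A) (w : List A) (i : ℕ) : Prop :=
  ∀ k, k < w.length → w[k]? = some (x (i + k))

/-- The language of a shift: all finite words occurring in points of `Ω`. -/
def language {A : Type*} (Ω : Set (ℕ → A)) : Set (List A) :=
  {w | ∃ x ∈ Ω, ∃ i, occursAt x w i}

/-- Words of length `n` in the language of `Ω`. -/
def Lang {A : Type*} (Ω : Set (ℕ → A)) (n : ℕ) : Set (List A) :=
  {w | w ∈ language Ω ∧ w.length = n}

/-- The complexity function `p(n)`. -/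
noncomputable def complexity {A : Type*} (Ω : Set (ℕ → A)) (n : ℕ) : ℕ :=
  (Lang Ω n).ncard

/-- Right extensions of `w`: words of length `|w|+1` in the language with prefix `w`. -/
def rightExt {A : Type*} (Ω : Set (ℕ → A)) (w : List A) : Set (List A) :=
  {w' | w' ∈ Lang Ω (w.length + 1) ∧ w <+: w'}

/-- Left extensions of `w`: words of length `|w|+1` in the language with suffix `w`. -/
def leftExt {A : Type*} (Ω : Set (ℕ → A)) (w : List A) : Set (List A) :=
  {w' | w' ∈ Lang Ω (w.length + 1) ∧ w <:+ w'}

/-- `s`-sided extensions: `true` = right, `false` = left. -/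
def ext {A : Type*} (Ω : Set (ℕ → A)) (s : Bool) (w : List A) : Set (List A) :=
  if s then rightExt Ω w else leftExt Ω w

/-- `ψ_s(n)`: the maximal number of `s`-extensions over words of length `n`. -/
noncomputable def psi {A : Type*} (Ω : Set (ℕ → A)) (s : Bool) (n : ℕ) : ℕ :=
  sSup ((fun w => (ext Ω s w).ncard) '' Lang Ω n)

/-- `s`-special words of length `n`: those with at least two `s`-extensions. -/
def specialWords {A : Type*} (Ω : Set (ℕ → A)) (s : Bool) (n : ℕ) : Set (List A) :=
  {w | w ∈ Lang Ω n ∧ 2 ≤ (ext Ω s w).ncard}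

/-- A bispecial word: both left special and right special. -/
def IsBispecial {A : Type*} (Ω : Set (ℕ → A)) (w : List A) : Prop :=
  2 ≤ (leftExt Ω w).ncard ∧ 2 ≤ (rightExt Ω w).ncard

/-- Two-sided extensions of `w`: words of length `|w|+2` with middle factor `w`. -/
def twoSidedExt {A : Type*} (Ω : Set (ℕ → A)) (w : List A) : Set (List A) :=
  {w'' | w'' ∈ Lang Ω (w.length + 2) ∧ ((w''.drop 1).take w.length) = w}

open MeasureTheory

/-- The cylinder set of a finite word `u`. -/
def cylinder {A : Type*} (u : List A) : Set (ℕ → A) :=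
  {x | occursAt x u 0}

open Classical in
/-- Number of occurrences of `u` in the word `w`. -/
noncomputable def countOccWord {A : Type*} (u w : List A) : ℕ :=
  ((Finset.range (w.length + 1)).filter
    (fun i => i + u.length ≤ w.length ∧ ((w.drop i).take u.length) = u)).card

open Classical in
/-- Number of occurrences of `u` in the length-`M` prefix of `x`. -/
noncomputable def countOccPrefix {A : Type*} (u : List A) (x : ℕ → A) (M : ℕ) : ℕ :=
  ((Finset.range (M + 1)).filter
    (fun i => i + u.length ≤ M ∧ occursAt x u i)).card

open Classical in
/-- Indicator that `w` begins somewhere in the `j`-th block of length `L|w|` of `x`. -/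
noncomputable def rBlock {A : Type*} (L : ℕ) (w : List A) (x : ℕ → A) (j : ℕ) : ℕ :=
  if ∃ i, j * (L * w.length) ≤ i ∧ i < (j + 1) * (L * w.length) ∧ occursAt x w i
  then 1 else 0

noncomputable def sumFn {A : Type*} (L : ℕ) (w : List A) (x : ℕ → A) (N : ℕ) : ℕ :=
  ∑ j ∈ Finset.range N, rBlock L w x j

/-- The disjoint upper density `D_L(w,x)`. -/
noncomputable def densD {A : Type*} (L : ℕ) (w : List A) (x : ℕ → A) : ℝ :=
  Filter.limsup (fun N => (sumFn L w x N : ℝ) / N) Filter.atTop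

open Filter Topology in
lemma aux_limsup_le {f g : ℕ → ℝ} {v : ℝ} (hf : ∀ n, 0 ≤ f n) (h : ∀ᶠ n in atTop, f n ≤ g n)
    (hg : Tendsto g atTop (𝓝 v)) : limsup f atTop ≤ v := by
  rw [← hg.limsup_eq]
  exact limsup_le_limsup h
    (IsBoundedUnder.isCoboundedUnder_le ⟨0, eventually_map.2 (Eventually.of_forall hf)⟩)
    hg.isBoundedUnder_le

lemma aux_rBlock_le {A : Type*} (L : ℕ) (w : List A) (x : ℕ → A) (j : ℕ) :
    rBlock L w x j ≤ 1 := by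
  unfold rBlock; split_ifs <;> simp

lemma aux_sumFn_le {A : Type*} (L : ℕ) (w : List A) (x : ℕ → A) (N : ℕ) :
    sumFn L w x N ≤ N := by
  unfold sumFn
  calc _ ≤ ∑ j ∈ Finset.range N, 1 := Finset.sum_le_sum fun j _ => aux_rBlock_le L w x j
    _ = N := by simp

open Filter in
lemma aux_densD_nonneg {A : Type*} (L : ℕ) (w : List A) (x : ℕ → A) : 0 ≤ densD L w x := by
  unfold densD
  refine le_limsup_of_frequently_le (Frequently.of_forall fun N => by positivity) ?_
  refine ⟨1, ?_⟩
  simp only [eventually_map]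
  refine Eventually.of_forall fun N => ?_
  apply div_le_one_of_le₀ _ (by positivity)
  exact_mod_cast aux_sumFn_le L w x N

/-- an occurrence of `u` inside an occurrence of `w` is an occurrence of `u` in `x` -/
lemma aux_occ {A : Type*} (u w : List A) (x : ℕ → A) (p i : ℕ) (hp : occursAt x w p)
    (hi : i + u.length ≤ w.length) (hu : (w.drop i).take u.length = u) :
    occursAt x u (p + i) := by
  intro k hk
  rw [← hu]
  rw [List.getElem?_take_of_lt hk, List.getElem?_drop, hp (i + k) (by omega)]
  congr 2; omega

open Classical in
lemma aux_count {A : Type*} (u w : List A) (x : ℕ → A) (L N : ℕ) (hL : 0 < L)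
    (hw : 0 < w.length) :
    sumFn L w x N * countOccWord u w ≤ countOccPrefix u x ((N + 1) * (L * w.length)) * 2 := by
  set B := L * w.length with hB
  have hBw : w.length ≤ B := Nat.le_mul_of_pos_left _ hL
  have hBpos : 0 < B := by omega
  set P : ℕ → Prop := fun j => ∃ i, j * B ≤ i ∧ i < (j + 1) * B ∧ occursAt x w i with hP
  have hsum : sumFn L w x N = ((Finset.range N).filter P).card := by
    rw [Finset.card_filter]; rfl
  have hex : ∀ j, ∃ p, P j → j * B ≤ p ∧ p < (j + 1) * B ∧ occursAt x w p := by
    intro j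
    by_cases h : P j
    · obtain ⟨p, hp⟩ := h
      exact ⟨p, fun _ => hp⟩
    · exact ⟨0, fun h' => absurd h' h⟩
  choose p hp using hex
  rw [hsum]
  unfold countOccPrefix
  refine Finset.card_mul_le_card_mul
    (fun j i => p j ≤ i ∧ i ≤ p j + w.length) ?_ ?_
  · intro j hj
    obtain ⟨hjN, hPj⟩ := Finset.mem_filter.1 hj
    obtain ⟨h1, h2, h3⟩ := hp j hPj
    have hjN' : j + 1 ≤ N := by simpa using hjN
    have hmul : (j + 1) * B ≤ N * B := Nat.mul_le_mul_right _ hjN'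
    have hN1 : (N + 1) * B = N * B + B := by ring
    unfold countOccWord
    refine Finset.card_le_card_of_injOn (fun i => p j + i) ?_ ?_
    · intro i hi
      obtain ⟨hi0, hi1, hi2⟩ := Finset.mem_filter.1 hi
      simp only [Finset.bipartiteAbove, Finset.coe_filter, Finset.mem_filter, Finset.mem_range,
        Set.mem_ofPred_eq]
      refine ⟨⟨by omega, by omega, aux_occ u w x _ _ h3 hi1 hi2⟩, by omega, by omega⟩
    · intro a _ b _ hab
      simpa using hab
  · intro i _
    calc _ ≤ ({i / B, i / B - 1} : Finset ℕ).card := by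
          apply Finset.card_le_card
          intro j hj
          simp only [Finset.bipartiteBelow, Finset.mem_filter] at hj
          obtain ⟨⟨_, hPj⟩, h4, h5⟩ := hj
          obtain ⟨h1, h2, h3⟩ := hp j hPj
          have e1 : j ≤ i / B := (Nat.le_div_iff_mul_le hBpos).2 (by omega)
          have e2 : i / B < j + 2 := (Nat.div_lt_iff_lt_mul hBpos).2 (by
            have : (j + 2) * B = (j + 1) * B + B := by ring
            omega)
          simp only [Finset.mem_insert, Finset.mem_singleton]
          omega
      _ ≤ 2 := Finset.card_le_two

open Filter Topology in
lemma aux_dens {A : Type*} (u w : List A) (x : ℕ → A) (L : ℕ) (hL : 0 < L)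
    (hw : 0 < w.length) (v : ℝ) (hv : 0 ≤ v)
    (hgen : Tendsto (fun M => (countOccPrefix u x M : ℝ) / M) atTop (𝓝 v)) :
    densD L w x * ((countOccWord u w : ℝ) / w.length / (2 * L)) ≤ v := by
  set K : ℝ := (countOccWord u w : ℝ) / w.length / (2 * L) with hK
  have hK0 : 0 ≤ K := by positivity
  rcases hK0.eq_or_lt with h | hKpos
  · rw [← h]; simpa using hv
  rw [← le_div_iff₀ hKpos]
  have hLw : 0 < L * w.length := Nat.mul_pos hL hw
  have t1 : Tendsto (fun N : ℕ => (N + 1) * (L * w.length)) atTop atTop := by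
    refine tendsto_atTop_mono (fun N => ?_) tendsto_id
    simp only [id]
    nlinarith
  have t2 := hgen.comp t1
  have t3 : Tendsto (fun N : ℕ => 1 + 1 / (N : ℝ)) atTop (𝓝 (1 + 0)) :=
    tendsto_const_nhds.add tendsto_one_div_atTop_nhds_zero_nat
  have t4 := (t2.mul t3).div_const K
  rw [add_zero, mul_one] at t4
  refine aux_limsup_le (fun N => by positivity) ?_ t4
  filter_upwards [eventually_gt_atTop 0] with N hN
  rw [le_div_iff₀ hKpos, hK]
  have hc : (sumFn L w x N : ℝ) * countOccWord u w
      ≤ countOccPrefix u x ((N + 1) * (L * w.length)) * 2 := by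
    exact_mod_cast aux_count u w x L N hL hw
  simp only [Function.comp]
  have hNr : (0 : ℝ) < N := by exact_mod_cast hN
  have hLr : (0 : ℝ) < L := by exact_mod_cast hL
  have hwr : (0 : ℝ) < w.length := by exact_mod_cast hw
  push_cast
  set c := (countOccPrefix u x ((N + 1) * (L * w.length)) : ℝ)
  have e1 : (sumFn L w x N : ℝ) / N * ((countOccWord u w : ℝ) / w.length / (2 * L))
      = ((sumFn L w x N : ℝ) * countOccWord u w) / (N * w.length * L * 2) := by
    field_simp
  have e2 : c / ((N + 1) * (L * w.length)) * (1 + 1 / (N : ℝ))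
      = (c * 2) / (N * w.length * L * 2) := by
    field_simp
  rw [e1, e2]
  gcongr

lemma aux_preimage {A : Type*} (k : ℕ) (f : Fin k → A) :
    (fun (y : ℕ → A) (i : Fin k) => y i) ⁻¹' {f} = cylinder (List.ofFn f) := by
  ext y
  simp only [_root_.cylinder, occursAt, Set.mem_preimage, Set.mem_singleton_iff, Set.mem_ofPred_eq,
    List.length_ofFn, zero_add]
  constructor
  · rintro h i hi
    subst h
    simp [hi]
  · intro h
    funext i
    have := h i i.2
    simpa using this.symm

open MeasureTheory Filter Topology in
lemma aux_ac {A : Type*} [Fintype A]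
    [TopologicalSpace A] [DiscreteTopology A]
    [MeasurableSpace A] [DiscreteMeasurableSpace A]
    (μ ν : Measure (ℕ → A)) [IsProbabilityMeasure μ] [IsProbabilityMeasure ν]
    (c : ENNReal) (hc : c ≠ 0)
    (h : ∀ u : List A, c * μ (cylinder u) ≤ ν (cylinder u)) : μ ≪ ν := by
  let r : ∀ k : ℕ, (ℕ → A) → (Fin k → A) := fun k y i => y i
  have hr : ∀ k, Measurable (r k) := fun k => by
    apply measurable_pi_lambda
    intro i
    exact measurable_pi_apply _
  have hpre : ∀ k (s : Set (Fin k → A)), c * μ (r k ⁻¹' s) ≤ ν (r k ⁻¹' s) := by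
    intro k s
    classical
    have key : ∀ (ρ : Measure (ℕ → A)), ρ (r k ⁻¹' s)
        = ∑ f ∈ s.toFinset, ρ (cylinder (List.ofFn f)) := by
      intro ρ
      rw [← Measure.map_apply (hr k) s.toFinite.measurableSet]
      conv_lhs => rw [← Set.coe_toFinset s]
      rw [← sum_measure_singleton]
      refine Finset.sum_congr rfl fun f _ => ?_
      rw [Measure.map_apply (hr k) (measurableSet_singleton f), ← aux_preimage]
    rw [key, key, Finset.mul_sum]
    exact Finset.sum_le_sum fun f _ => h _
  have hopen : ∀ U : Set (ℕ → A), IsOpen U → c * μ U ≤ ν U := by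
    intro U hU
    have hUn : U = ⋃ k, r k ⁻¹' {f | r k ⁻¹' {f} ⊆ U} := by
      ext y
      simp only [Set.mem_iUnion, Set.mem_preimage, Set.mem_ofPred_eq]
      constructor
      · intro hy
        obtain ⟨_, ⟨z, k, rfl⟩, hyz, hsub⟩ :=
          (PiNat.isTopologicalBasis_cylinders (fun _ : ℕ => A)).exists_subset_of_mem_open hy hU
        refine ⟨k, fun y' hy' => hsub ?_⟩
        intro i hi
        have := congrFun hy' ⟨i, hi⟩
        exact (show y' i = y i from this).trans (hyz i hi)
      · rintro ⟨k, hk⟩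
        exact hk rfl
    have hmono : Monotone fun k => r k ⁻¹' {f | r k ⁻¹' {f} ⊆ U} := by
      intro k l hkl y hy
      simp only [Set.mem_preimage, Set.mem_ofPred_eq] at hy ⊢
      refine fun y' hy' => hy ?_
      funext i
      exact congrFun hy' ⟨i, i.2.trans_le hkl⟩
    rw [hUn, hmono.measure_iUnion, hmono.measure_iUnion, ENNReal.mul_iSup]
    exact iSup_mono fun k => hpre k _
  intro s hs
  have hle : ∀ ε > (0 : ENNReal), c * μ s ≤ ε := by
    intro ε hε
    obtain ⟨U, hsU, hU, hlt⟩ := s.exists_isOpen_lt_of_lt (μ := ν) ε (by rw [hs]; exact hε)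
    calc c * μ s ≤ c * μ U := by gcongr
      _ ≤ ν U := hopen U hU
      _ ≤ ε := hlt.le
  have : c * μ s = 0 := le_antisymm (le_of_forall_gt_imp_ge_of_dense hle) bot_le
  exact (mul_eq_zero.1 this).resolve_left hc

/-- if the sequence of words `w n` generates `μ`, `x` is generic
for the ergodic measure `ν`, and `β = limsup_n D_L(w n, x) > 0`, then
`ν([u]) ≥ (β/(2L))·μ([u])` for every word `u`, and consequently `ν = μ`. -/
theorem dens_meas {A : Type*} [Fintype A]
    [TopologicalSpace A] [DiscreteTopology A]
    [MeasurableSpace A] [DiscreteMeasurableSpace A]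
    (Ω : Set (ℕ → A)) (hmin : IsMinimalSubshift Ω)
    (μ ν : Measure (ℕ → A)) [IsProbabilityMeasure μ] [IsProbabilityMeasure ν]
    (hμinv : MeasurePreserving (shiftMap (A := A)) μ μ)
    (hνerg : Ergodic (shiftMap (A := A)) ν)
    (hμΩ : μ Ω = 1) (hνΩ : ν Ω = 1)
    (x : ℕ → A) (hx : x ∈ Ω)
    (hgen : ∀ u : List A,
      Filter.Tendsto (fun M => (countOccPrefix u x M : ℝ) / M)
        Filter.atTop (nhds ((ν (cylinder u)).toReal)))
    (w : ℕ → List A) (hwL : ∀ n, w n ∈ language Ω)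
    (hlen : Filter.Tendsto (fun n => (w n).length) Filter.atTop Filter.atTop)
    (hgenμ : ∀ u : List A,
      Filter.Tendsto (fun n => (countOccWord u (w n) : ℝ) / (w n).length)
        Filter.atTop (nhds ((μ (cylinder u)).toReal)))
    (L : ℕ) (hL : 0 < L)
    (β : ℝ) (hβdef : β = Filter.limsup (fun n => densD L (w n) x) Filter.atTop)
    (hβ : 0 < β) :
    (∀ u : List A,
        (β / (2 * L)) * (μ (cylinder u)).toReal ≤ (ν (cylinder u)).toReal) ∧
      ν = μ := by
  have hLr : (0 : ℝ) < L := by exact_mod_cast hL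
  have main : ∀ u : List A,
      (β / (2 * L)) * (μ (cylinder u)).toReal ≤ (ν (cylinder u)).toReal := by
    intro u
    set v := (ν (cylinder u)).toReal with hv
    have hv0 : 0 ≤ v := ENNReal.toReal_nonneg
    have t1 := (hgenμ u).div_const (2 * (L : ℝ))
    have hm0 : 0 ≤ (μ (cylinder u)).toReal := ENNReal.toReal_nonneg
    rcases hm0.eq_or_lt with h | hm
    · rw [← h]; simpa using hv0
    set K := (μ (cylinder u)).toReal / (2 * L) with hK
    have hKpos : 0 < K := by positivity
    have e : β / (2 * L) * (μ (cylinder u)).toReal = β * K := by rw [hK]; ring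
    rw [e, ← le_div_iff₀ hKpos, hβdef]
    refine aux_limsup_le (fun n => aux_densD_nonneg _ _ _) ?_
      (tendsto_const_nhds.div t1 hKpos.ne')
    filter_upwards [hlen.eventually_gt_atTop 0, t1.eventually_const_lt hKpos] with n hn hn'
    rw [Pi.div_apply, le_div_iff₀ hn']
    exact aux_dens u (w n) x L hL hn v hv0 (hgen u)
  refine ⟨main, ?_⟩
  have hc : 0 < β / (2 * L) := by positivity
  have hac : μ ≪ ν := by
    refine aux_ac μ ν (ENNReal.ofReal (β / (2 * L))) (by simpa using hc) ?_
    intro u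
    have := ENNReal.ofReal_le_ofReal (main u)
    rwa [ENNReal.ofReal_mul hc.le, ENNReal.ofReal_toReal (measure_ne_top _ _),
      ENNReal.ofReal_toReal (measure_ne_top _ _)] at this
  exact (hνerg.eq_of_absolutelyContinuous hμinv hac).symm
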